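/- Let X and Y be nonempty compact metric spaces, f : X → X and g : Y → Y continuous maps, and π : X → Y a continuous surjection satisfying π ∘ f = g ∘ π. Assume that every ergodic f-invariant Borel probability measure μ on X whose pushforward π_*μ has finite support itself has finite support. Then π(Per(f)) = Per(g), where Per(f) = {x ∈ X : there exists n ≥ 1 with fⁿ(x) = x} and Per(g) is defined analogously. -/

import Mathlib

open MeasureTheory

/-- A measure is finitely supported if some finite set has full measure. -/
def FinitelySupported {α : Type*} [MeasurableSpace α] (μ : Measure α) : Prop :=
  ∃ S : Set α, S.Finite ∧ μ S = 1

open MeasureTheory Filter Topology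
open scoped ENNReal BoundedContinuousFunction

lemma exists_invariant_aux {Z : Type*} [MetricSpace Z] [CompactSpace Z] [Nonempty Z]
    [MeasurableSpace Z] [BorelSpace Z] (f : Z → Z) (hf : Continuous f) :
    ∃ μ : ProbabilityMeasure Z, (μ : Measure Z).map f = μ := by
  obtain ⟨x⟩ := ‹Nonempty Z›
  let m : ℕ → Measure Z := fun n =>
    ((n + 1 : ℕ) : ℝ≥0∞)⁻¹ • ∑ k ∈ Finset.range (n + 1), Measure.dirac (f^[k] x)
  have hm : ∀ n, IsProbabilityMeasure (m n) := fun n => ⟨by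
    simp only [m, Measure.smul_apply, Measure.finsetSum_apply, measure_univ, smul_eq_mul,
      Finset.sum_const, Finset.card_range, nsmul_eq_mul, mul_one]
    exact ENNReal.inv_mul_cancel (by simp) (ENNReal.natCast_ne_top _)⟩
  have hint : ∀ n (φ : Z →ᵇ ℝ), ∫ z, φ z ∂(m n) = birkhoffAverage ℝ f φ (n + 1) x := by
    intro n φ
    simp only [m]
    rw [integral_smul_measure, integral_finsetSum_measure]
    · simp only [birkhoffAverage, birkhoffSum, integral_dirac, ENNReal.toReal_inv,
        ENNReal.toReal_natCast]
    · intro i _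
      exact φ.integrable _
  let P : ℕ → ProbabilityMeasure Z := fun n => ⟨m n, hm n⟩
  obtain ⟨μ, -, hμ⟩ := isCompact_univ.ultrafilter_le_nhds ((hyperfilter ℕ).map P)
    (by simp)
  have hT : Tendsto P (hyperfilter ℕ) (𝓝 μ) := hμ
  rw [ProbabilityMeasure.tendsto_iff_forall_integral_tendsto] at hT
  refine ⟨μ, ?_⟩
  have := Measure.isProbabilityMeasure_map (μ := (μ : Measure Z)) hf.aemeasurable
  apply ext_of_forall_integral_eq_of_IsFiniteMeasure
  intro φ
  rw [integral_map hf.aemeasurable φ.continuous.aestronglyMeasurable]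
  have h1 := hT (φ.compContinuous ⟨f, hf⟩)
  have h2 := hT φ
  have h3 := ((tendsto_birkhoffAverage_apply_sub_birkhoffAverage' ℝ (g := φ)
    φ.isBounded_range f x).comp (tendsto_add_atTop_nat 1)).mono_left
      (Nat.hyperfilter_le_atTop)
  have h4 : ∀ n, ∫ z, (φ.compContinuous ⟨f, hf⟩) z ∂(P n : Measure Z)
      - ∫ z, φ z ∂(P n : Measure Z)
      = birkhoffAverage ℝ f φ (n + 1) (f x) - birkhoffAverage ℝ f φ (n + 1) x := by
    intro n
    have e1 := hint n φ
    have e2 := hint n (φ.compContinuous ⟨f, hf⟩)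
    change ∫ z, (φ.compContinuous ⟨f, hf⟩) z ∂(m n) - ∫ z, φ z ∂(m n) = _
    rw [e1, e2]
    congr 1
    simp only [birkhoffAverage, birkhoffSum]
    congr 1
    apply Finset.sum_congr rfl
    intro k _
    change φ (f (f^[k] x)) = φ (f^[k] (f x))
    rw [← Function.iterate_succ_apply, Function.iterate_succ_apply']
  have h5 := h1.sub h2
  simp only [h4] at h5
  have := tendsto_nhds_unique h5 h3
  exact sub_eq_zero.1 this

lemma exists_ergodic_aux {Z : Type*} [MetricSpace Z] [CompactSpace Z] [Nonempty Z]
    [MeasurableSpace Z] [BorelSpace Z] (f : Z → Z) (hf : Continuous f) :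
    ∃ μ : Measure Z, IsProbabilityMeasure μ ∧ Ergodic f μ := by
  let I : Set (ProbabilityMeasure Z) :=
    {μ | ProbabilityMeasure.map μ hf.measurable.aemeasurable = μ}
  have hIc : IsCompact I :=
    (isClosed_eq (ProbabilityMeasure.continuous_map hf) continuous_id).isCompact
  have hIn : I.Nonempty := by
    obtain ⟨μ, hμ⟩ := exists_invariant_aux f hf
    exact ⟨μ, Subtype.ext hμ⟩
  let Φ : ProbabilityMeasure Z → ((Z →ᵇ ℝ) → ℝ) := fun μ φ => ∫ z, φ z ∂(μ : Measure Z)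
  have hΦ : Continuous Φ := by
    apply continuous_pi
    intro φ
    rw [continuous_iff_continuousAt]
    intro μ
    exact (ProbabilityMeasure.tendsto_iff_forall_integral_tendsto.1 tendsto_id) φ
  have hinj : ∀ μ ν, Φ μ = Φ ν → μ = ν := by
    intro μ ν h
    apply Subtype.ext
    exact ext_of_forall_integral_eq_of_IsFiniteMeasure (μ := μ.toMeasure) (ν := ν.toMeasure)
      (fun φ => congrFun h φ)
  obtain ⟨e, he⟩ := (hIc.image hΦ).extremePoints_nonempty (hIn.image Φ)
  rw [mem_extremePoints_iff_left] at he
  obtain ⟨⟨μ, hμI, rfl⟩, he⟩ := he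
  refine ⟨μ, inferInstance, Ergodic.of_mem_extremePoints ?_⟩
  rw [mem_extremePoints_iff_left]
  refine ⟨⟨⟨hf.measurable, congrArg Subtype.val hμI⟩, inferInstance⟩, ?_⟩
  rintro ν₁ ⟨h₁, p₁⟩ ν₂ ⟨h₂, p₂⟩ ⟨a, b, ha, hb, hab, habμ⟩
  have hat : a ≠ ∞ := by rintro rfl; simp at hab
  have hbt : b ≠ ∞ := by rintro rfl; simp at hab
  have key := he (Φ ⟨ν₁, p₁⟩) ⟨⟨ν₁, p₁⟩, Subtype.ext h₁.map_eq, rfl⟩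
    (Φ ⟨ν₂, p₂⟩) ⟨⟨ν₂, p₂⟩, Subtype.ext h₂.map_eq, rfl⟩
    ⟨a.toReal, b.toReal, ENNReal.toReal_pos ha.ne' hat, ENNReal.toReal_pos hb.ne' hbt, by
      rw [← ENNReal.toReal_add hat hbt, hab]; simp, by
      funext φ
      change a.toReal * ∫ z, φ z ∂ν₁ + b.toReal * ∫ z, φ z ∂ν₂ = ∫ z, φ z ∂(μ : Measure Z)
      rw [← habμ, integral_add_measure ((φ.integrable _).smul_measure hat)
        ((φ.integrable _).smul_measure hbt), integral_smul_measure, integral_smul_measure]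
      simp⟩
  exact congrArg Subtype.val (hinj _ _ key)

/-- If `π` is a continuous surjective semiconjugacy from `(X, f)` to `(Y, g)`
(compact metric spaces) and every ergodic `f`-invariant Borel probability measure whose
pushforward under `π` is finitely supported is itself finitely supported, then
`π(Per(f)) = Per(g)`. -/
theorem image_periodic_points
    {X Y : Type*}
    [MetricSpace X] [CompactSpace X] [Nonempty X] [MeasurableSpace X] [BorelSpace X]
    [MetricSpace Y] [CompactSpace Y] [Nonempty Y] [MeasurableSpace Y] [BorelSpace Y]
    (f : X → X) (g : Y → Y) (π : X → Y)
    (hf : Continuous f) (hg : Continuous g) (hπ : Continuous π)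
    (hπsurj : Function.Surjective π)
    (hsemi : π ∘ f = g ∘ π)
    (hstep : ∀ μ : Measure X, IsProbabilityMeasure μ → Ergodic f μ →
      FinitelySupported (μ.map π) → FinitelySupported μ) :
    π '' {x : X | ∃ n : ℕ, 1 ≤ n ∧ f^[n] x = x} =
      {y : Y | ∃ n : ℕ, 1 ≤ n ∧ g^[n] y = y} := by
  have hs : Function.Semiconj π f g := fun x => congrFun hsemi x
  apply Set.Subset.antisymm
  · rintro _ ⟨x, ⟨n, hn, hx⟩, rfl⟩
    exact ⟨n, hn, by rw [← (hs.iterate_right n) x, hx]⟩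
  · rintro y ⟨n, hn, hy⟩
    let O : Set Y := (fun k => g^[k] y) '' Set.Iio n
    have hOfin : O.Finite := (Set.finite_Iio n).image _
    have hgO : ∀ z ∈ O, g z ∈ O := by
      rintro _ ⟨k, hk, rfl⟩
      have hk' : k < n := hk
      rcases Nat.lt_or_ge (k + 1) n with h | h
      · exact ⟨k + 1, h, Function.iterate_succ_apply' g k y⟩
      · have hkn : k + 1 = n := by omega
        refine ⟨0, hn, ?_⟩
        change y = g (g^[k] y)
        rw [← Function.iterate_succ_apply' g k y, Nat.succ_eq_add_one, hkn, hy]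
    let K : Set X := π ⁻¹' O
    have hKc : IsClosed K := hOfin.isClosed.preimage hπ
    have hfK : Set.MapsTo f K K := by
      intro x hx
      change π (f x) ∈ O
      rw [hs x]
      exact hgO _ hx
    obtain ⟨x₀, hx₀⟩ := hπsurj y
    have : Nonempty K := ⟨⟨x₀, 0, hn, hx₀.symm⟩⟩
    have : CompactSpace K := isCompact_iff_compactSpace.1 hKc.isCompact
    obtain ⟨ν, hν, hE⟩ := exists_ergodic_aux (hfK.restrict f K K) (hf.restrict hfK)
    let μ : Measure X := ν.map Subtype.val
    have hμ : IsProbabilityMeasure μ :=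
      Measure.isProbabilityMeasure_map measurable_subtype_coe.aemeasurable
    have hmp : MeasurePreserving (Subtype.val : K → X) ν μ := ⟨measurable_subtype_coe, rfl⟩
    have hEμ : Ergodic f μ := hmp.ergodic_of_ergodic_semiconj hE hf.measurable (fun _ => rfl)
    have hμK : μ K = 1 := by
      rw [← hmp.measure_preimage hKc.measurableSet.nullMeasurableSet]
      simp
    obtain ⟨S, hS, hμS⟩ := hstep μ hμ hEμ ⟨O, hOfin, by
      rw [Measure.map_apply hπ.measurable hOfin.measurableSet]; exact hμK⟩
    have hSK : μ (S ∩ K) ≠ 0 := by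
      have h1 : μ Kᶜ = 0 := (prob_compl_eq_zero_iff hKc.measurableSet).2 hμK
      intro h0
      have : μ S ≤ 0 := by
        calc μ S ≤ μ ((S ∩ K) ∪ Kᶜ) := measure_mono (by intro z hz; by_cases h : z ∈ K <;> simp [*])
          _ ≤ μ (S ∩ K) + μ Kᶜ := measure_union_le _ _
          _ = 0 := by rw [h0, h1, add_zero]
      rw [hμS] at this
      simp at this
    obtain ⟨x, hxSK, hx⟩ : ∃ x ∈ S ∩ K, μ {x} ≠ 0 := by
      by_contra! hcon
      apply hSK
      rw [← Set.biUnion_of_singleton (S ∩ K)]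
      exact (measure_biUnion_null_iff (hS.inter_of_left K).countable).2 hcon
    obtain ⟨x', hx', m, hm, hmx⟩ := hEμ.toMeasurePreserving.exists_mem_iterate_mem
      (measurableSet_singleton x).nullMeasurableSet hx
    rw [Set.mem_singleton_iff] at hx' hmx
    subst hx'
    obtain ⟨k, hk, hkx⟩ := hxSK.2
    have hk' : g^[k] y = π x' := hkx
    refine ⟨f^[n * k - k] x', ⟨m, Nat.one_le_iff_ne_zero.2 hm, ?_⟩, ?_⟩
    · rw [← Function.iterate_add_apply, add_comm, Function.iterate_add_apply, hmx]
    · rw [(hs.iterate_right _) x', ← hk', ← Function.iterate_add_apply,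
        Nat.sub_add_cancel (Nat.le_mul_of_pos_left k hn)]
      exact (Function.IsPeriodicPt.mul_const (show Function.IsPeriodicPt g n y from hy) k)
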